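/- Let Y = (Y_1,…,Y_p)ᵀ be a p-dimensional centered Gaussian vector such that E(Y_j²) ≥ c₁ for all 1 ≤ j ≤ p, for some constant c₁ > 0, and p ≥ 2. Then for any random variables X, X′ and any δ > 0: sup_{x ∈ ℝ, A ⊆ [p]} | P(|X′| > x) − P(|Y[A]|_∞ > x) | ≤ sup_{x ∈ ℝ, A ⊆ [p]} | P(|X| > x) − P(|Y[A]|_∞ > x) | + P(|X − X′| > δ) + C δ √(log p), where C is a constant depending only on c₁. -/

import Mathlib

open MeasureTheory ProbabilityTheory Filter Set
open scoped ENNReal NNReal BigOperators Topology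

noncomputable section

namespace AJDN

/-- `Y` is a centered Gaussian random vector: it is measurable, its coordinates are
centered, and every linear combination of its coordinates is Gaussian. -/
def IsCenteredGaussianVec {Ω : Type*} [MeasurableSpace Ω] (μ : Measure Ω)
    {p : ℕ} (Y : Ω → Fin p → ℝ) : Prop :=
  Measurable Y ∧ (∀ j, ∫ ω, Y ω j ∂μ = 0) ∧
    ∀ a : Fin p → ℝ, ∃ v : ℝ≥0,
      Measure.map (fun ω => ∑ j, a j * Y ω j) μ = gaussianReal 0 v

/-- `j` is the least index at which `z` attains its maximum. -/
def IsFirstArgmax {ι : Type*} [LinearOrder ι] (z : ι → ℝ) (j : ι) : Prop :=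
  ∀ i, z i ≤ z j ∧ (i < j → z i < z j)

lemma IsFirstArgmax.eq {ι : Type*} [LinearOrder ι] {z : ι → ℝ} {j k : ι}
    (hj : IsFirstArgmax z j) (hk : IsFirstArgmax z k) : j = k := by
  rcases lt_trichotomy j k with h | h | h
  · exact absurd ((hk j).2 h) (not_lt.2 (hj k).1)
  · exact h
  · exact absurd ((hj k).2 h) (not_lt.2 (hk j).1)

lemma exists_isFirstArgmax {ι : Type*} [LinearOrder ι] [Fintype ι] [Nonempty ι] (z : ι → ℝ) :
    ∃ j, IsFirstArgmax z j := by
  classical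
  obtain ⟨m, -, hm⟩ := Finset.exists_max_image Finset.univ z Finset.univ_nonempty
  obtain ⟨j, hj, hmin⟩ := Finset.exists_min_image
    (Finset.univ.filter fun j => ∀ i, z i ≤ z j) id ⟨m, by simpa using hm⟩
  simp only [Finset.mem_filter, Finset.mem_univ, true_and, id] at hj hmin
  refine ⟨j, fun i => ⟨hj i, fun hij => lt_of_not_ge fun hge => ?_⟩⟩
  exact absurd (hmin i fun k => (hj k).trans hge) (not_le.2 hij)

lemma measurableSet_isFirstArgmax {ι : Type*} [LinearOrder ι] [Fintype ι] (j : ι) :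
    MeasurableSet {z : ι → ℝ | IsFirstArgmax z j} := by
  simp only [IsFirstArgmax, ofPred_forall, ofPred_and]
  refine MeasurableSet.iInter fun i => MeasurableSet.inter ?_ (MeasurableSet.iInter fun _ => ?_)
  · exact measurableSet_le (measurable_pi_apply i) (measurable_pi_apply j)
  · exact measurableSet_lt (measurable_pi_apply i) (measurable_pi_apply j)

/-- If the covariances with the standard Gaussian coordinate `W j` are at most `1`, then the
conditional probability, given `W j = w`, that `j` is the first maximizer is monotone in `w`. -/
lemma exists_monotone_density {Ω : Type*} [MeasurableSpace Ω] {μ : Measure Ω}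
    [IsProbabilityMeasure μ] {ι : Type*} [LinearOrder ι] [Fintype ι] {W : Ω → ι → ℝ}
    (hW : Measurable W) (hG : HasGaussianLaw W μ)
    (h1 : ∀ i, μ.map (fun ω => W ω i) = gaussianReal 0 1) (a : ι → ℝ) (j : ι) :
    ∃ G : ℝ → ℝ≥0∞, Monotone G ∧ (∀ w, G w ≤ 1) ∧ ∀ B, MeasurableSet B →
      μ {ω | IsFirstArgmax (fun i => W ω i - a i) j ∧ W ω j ∈ B}
        = ∫⁻ w in B, gaussianPDF 0 1 w * G w := by
  have hWi : ∀ i, Measurable fun ω => W ω i := fun i => (measurable_pi_apply i).comp hW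
  have hL2 : ∀ i, MemLp (fun ω => W ω i) 2 μ := fun i =>
    (HasGaussianLaw.eval (X := fun i ω => W ω i) hG i).memLp_two
  have hvar : ∀ i, Var[fun ω => W ω i; μ] = 1 := fun i => by
    have := variance_id_gaussianReal (μ := 0) (v := 1)
    rw [← h1 i, variance_map aemeasurable_id (hWi i).aemeasurable] at this
    simpa [Function.comp_def] using this
  set ρ : ι → ℝ := fun i => cov[fun ω => W ω j, fun ω => W ω i; μ] with hρ
  have hρ1 : ∀ i, ρ i ≤ 1 := fun i => by
    have h := variance_fun_sub (hL2 j) (hL2 i)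
    have h0 := variance_nonneg (fun ω => W ω j - W ω i) μ
    rw [h, hvar, hvar] at h0
    simp only [hρ]; linarith
  have hρj : ρ j = 1 := by
    simp only [hρ]; rw [covariance_self (hWi j).aemeasurable, hvar]
  let R : Ω → ι → ℝ := fun ω i => W ω i - ρ i * W ω j
  have hR : Measurable R := measurable_pi_lambda _ fun i => (hWi i).sub ((hWi j).const_mul _)
  have hind : IndepFun (fun ω => W ω j) R μ := by
    have hjoint : HasGaussianLaw (fun ω => (fun _ : Unit => W ω j, R ω)) μ := by
      have := hG.map_fun (ContinuousLinearMap.prod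
        (ContinuousLinearMap.pi fun _ : Unit => ContinuousLinearMap.proj (R := ℝ) j)
        (ContinuousLinearMap.pi fun i => ContinuousLinearMap.proj (R := ℝ) i
          - ρ i • ContinuousLinearMap.proj (R := ℝ) (φ := fun _ => ℝ) j))
      exact this
    have := hjoint.indepFun_of_covariance_eval (X := fun _ ω => W ω j) (Y := fun i ω => R ω i)
      fun _ i => by
        have := covariance_fun_sub_right (hL2 j) (hL2 i) ((hL2 j).const_mul (ρ i))
        simp only [R]
        rw [this, covariance_const_mul_right, covariance_self (hWi j).aemeasurable, hvar]
        simp [hρ]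
    exact this.comp (measurable_pi_apply ()) measurable_id
  let S : Set (ℝ × (ι → ℝ)) := {q | IsFirstArgmax (fun i => q.2 i + ρ i * q.1 - a i) j}
  have hS : MeasurableSet S := by
    refine (measurableSet_isFirstArgmax j).preimage (measurable_pi_lambda _ fun i => ?_)
    fun_prop
  have : IsProbabilityMeasure (μ.map R) := Measure.isProbabilityMeasure_map hR.aemeasurable
  have hmono : Monotone fun w => μ.map R (Prod.mk w ⁻¹' S) := by
    intro w w' hww
    have hkey : ∀ i, (1 - ρ i) * w ≤ (1 - ρ i) * w' := fun i =>
      mul_le_mul_of_nonneg_left hww (by linarith [hρ1 i])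
    refine measure_mono fun r hr i => ?_
    obtain ⟨h, h'⟩ := hr i
    simp only [hρj] at h h' ⊢
    exact ⟨by linarith [hkey i], fun hij => by linarith [hkey i, h' hij]⟩
  refine ⟨_, hmono, fun w => prob_le_one, fun B hB => ?_⟩
  have hset : {ω | IsFirstArgmax (fun i => W ω i - a i) j ∧ W ω j ∈ B}
      = (fun ω => (W ω j, R ω)) ⁻¹' (S ∩ Prod.fst ⁻¹' B) := by
    ext ω; simp [S, R]
  have hSB : MeasurableSet (S ∩ Prod.fst ⁻¹' B) := hS.inter (measurable_fst hB)
  rw [hset, ← Measure.map_apply ((hWi j).prodMk hR) hSB,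
    hind.map_prod_eq_prod_map_map (hWi j).aemeasurable hR.aemeasurable,
    Measure.prod_apply hSB, h1, gaussianReal_of_var_ne_zero _ one_ne_zero,
    lintegral_withDensity_eq_lintegral_mul _ (measurable_gaussianPDF 0 1)
      (measurable_measure_prodMk_left hSB), ← lintegral_indicator hB]
  refine lintegral_congr fun w => ?_
  by_cases hw : w ∈ B <;> simp [hw, preimage_inter, ← preimage_comp, Function.comp_def]

lemma gaussianPDF_le_three_mul {K w s : ℝ} (hK : 0 ≤ K) (hw : w ≤ K) (hs : 0 ≤ s)
    (hsK : s ≤ (K + 1)⁻¹) : gaussianPDF 0 1 w ≤ 3 * gaussianPDF 0 1 (w + s) := by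
  have h1 : s * (K + 1) ≤ 1 := by
    have := mul_le_mul_of_nonneg_right hsK (by linarith : 0 ≤ K + 1)
    rwa [inv_mul_cancel₀ (by linarith)] at this
  have h3 : (3 : ℝ≥0∞) = ENNReal.ofReal 3 := by simp
  rw [gaussianPDF, gaussianPDF, h3, ← ENNReal.ofReal_mul (by norm_num)]
  apply ENNReal.ofReal_le_ofReal
  simp only [gaussianPDFReal, NNReal.coe_one, mul_one, sub_zero]
  rw [mul_left_comm]
  refine mul_le_mul_of_nonneg_left ?_ (by positivity)
  have hexp : Real.exp 1 ≤ 3 := by linarith [Real.exp_one_lt_d9]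
  calc Real.exp (-w ^ 2 / 2) ≤ Real.exp (1 + -(w + s) ^ 2 / 2) := by
        apply Real.exp_le_exp.2
        nlinarith [mul_le_mul_of_nonneg_right hw hs, mul_nonneg hK hs]
    _ = Real.exp 1 * Real.exp (-(w + s) ^ 2 / 2) := Real.exp_add _ _
    _ ≤ _ := mul_le_mul_of_nonneg_right hexp (Real.exp_pos _).le

lemma gaussianPDF_mul_le_lintegral {K w : ℝ} (hK : 0 ≤ K) (hw : w ≤ K) {G : ℝ → ℝ≥0∞}
    (hG : Monotone G) :
    gaussianPDF 0 1 w * G w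
      ≤ ENNReal.ofReal (3 * (K + 1)) * ∫⁻ x in Ici w, gaussianPDF 0 1 x * G x := by
  have hK1 : 0 < K + 1 := by linarith
  have key : ENNReal.ofReal (K + 1)⁻¹ * (gaussianPDF 0 1 w * G w)
      ≤ 3 * ∫⁻ x in Ici w, gaussianPDF 0 1 x * G x := by
    calc ENNReal.ofReal (K + 1)⁻¹ * (gaussianPDF 0 1 w * G w)
        = ∫⁻ _ in Icc w (w + (K + 1)⁻¹), gaussianPDF 0 1 w * G w := by
          rw [setLIntegral_const, Real.volume_Icc, add_sub_cancel_left, mul_comm]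
      _ ≤ ∫⁻ x in Icc w (w + (K + 1)⁻¹), 3 * (gaussianPDF 0 1 x * G x) := by
          refine setLIntegral_mono' measurableSet_Icc fun x hx => ?_
          rw [← mul_assoc]
          refine mul_le_mul' ?_ (hG hx.1)
          have := gaussianPDF_le_three_mul hK hw (sub_nonneg.2 hx.1) (by linarith [hx.2])
          rwa [add_sub_cancel] at this
      _ ≤ ∫⁻ x in Ici w, 3 * (gaussianPDF 0 1 x * G x) :=
          lintegral_mono_set Icc_subset_Ici_self
      _ = _ := lintegral_const_mul' _ _ (by simp)
  calc gaussianPDF 0 1 w * G w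
      = ENNReal.ofReal (K + 1) * (ENNReal.ofReal (K + 1)⁻¹ * (gaussianPDF 0 1 w * G w)) := by
        rw [← mul_assoc, ← ENNReal.ofReal_mul hK1.le, mul_inv_cancel₀ hK1.ne']; simp
    _ ≤ ENNReal.ofReal (K + 1) * (3 * ∫⁻ x in Ici w, gaussianPDF 0 1 x * G x) := by gcongr
    _ = _ := by
        rw [ENNReal.ofReal_mul (by norm_num), ENNReal.ofReal_ofNat, ← mul_assoc,
          mul_comm (ENNReal.ofReal (K + 1))]

lemma gaussianPDF_le_exp {K w : ℝ} (hK : 0 ≤ K) (hw : K ≤ w) :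
    gaussianPDF 0 1 w ≤ ENNReal.ofReal (Real.exp (-K ^ 2 / 2)) := by
  apply ENNReal.ofReal_le_ofReal
  simp only [gaussianPDFReal, NNReal.coe_one, mul_one, sub_zero]
  calc _ ≤ 1 * Real.exp (-w ^ 2 / 2) := by
        refine mul_le_mul_of_nonneg_right (inv_le_one_of_one_le₀ ?_) (Real.exp_pos _).le
        rw [Real.one_le_sqrt]; linarith [Real.pi_gt_three]
    _ ≤ _ := by
        rw [one_mul]
        apply Real.exp_le_exp.2
        nlinarith

/-- **Nazarov's inequality** for a standardized Gaussian vector: the probability that the maximum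
of `W i - a i` lies in `(0, h]` is of order `h * K`, where `K` is of order `√(log n)`. -/
theorem nazarov {Ω : Type*} [MeasurableSpace Ω] {μ : Measure Ω}
    [IsProbabilityMeasure μ] {ι : Type*} [Fintype ι] {W : Ω → ι → ℝ}
    (hW : Measurable W) (hG : HasGaussianLaw W μ)
    (h1 : ∀ i, μ.map (fun ω => W ω i) = gaussianReal 0 1) (a : ι → ℝ) {K : ℝ} (hK : 0 ≤ K)
    (hcard : Fintype.card ι * Real.exp (-K ^ 2 / 2) ≤ 1) (h : ℝ) :
    μ {ω | (∃ i, a i < W ω i) ∧ ∀ i, W ω i ≤ a i + h}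
      ≤ ENNReal.ofReal (3 * K + 4) * ENNReal.ofReal h := by
  let : LinearOrder ι := LinearOrder.lift' (Fintype.equivFin ι) (Fintype.equivFin ι).injective
  choose G hmono hle hint using exists_monotone_density hW hG h1 a
  let F : ι → ℝ → ℝ≥0∞ := fun i w => gaussianPDF 0 1 w * G i w
  have hF : ∀ i, Measurable (F i) := fun i =>
    (measurable_gaussianPDF 0 1).mul (hmono i).measurable
  have hpoint : ∀ s : ℝ, ∑ i, F i (a i + s) ≤ ENNReal.ofReal (3 * K + 4) := by
    intro s
    have hterm : ∀ i, F i (a i + s) ≤ ENNReal.ofReal (3 * (K + 1)) *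
        μ {ω | IsFirstArgmax (fun i => W ω i - a i) i} + ENNReal.ofReal (Real.exp (-K ^ 2 / 2)) := by
      intro i
      rcases le_total (a i + s) K with hs | hs
      · refine le_add_right ((gaussianPDF_mul_le_lintegral hK hs (hmono i)).trans ?_)
        rw [← hint i _ measurableSet_Ici]
        gcongr
        exact fun hω => hω.1
      · refine le_add_left ?_
        calc F i (a i + s) ≤ gaussianPDF 0 1 (a i + s) * 1 := mul_le_mul_right (hle i _) _
          _ ≤ _ := by rw [mul_one]; exact gaussianPDF_le_exp hK hs
    have hmeas : ∀ i, MeasurableSet {ω | IsFirstArgmax (fun i => W ω i - a i) i} := fun i =>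
      (measurableSet_isFirstArgmax i).preimage
        (measurable_pi_lambda _ fun k => ((measurable_pi_apply k).comp hW).sub_const _)
    calc ∑ i, F i (a i + s)
        ≤ ∑ i, (ENNReal.ofReal (3 * (K + 1)) * μ {ω | IsFirstArgmax (fun i => W ω i - a i) i}
            + ENNReal.ofReal (Real.exp (-K ^ 2 / 2))) := Finset.sum_le_sum fun i _ => hterm i
      _ = ENNReal.ofReal (3 * (K + 1)) * μ (⋃ i, {ω | IsFirstArgmax (fun i => W ω i - a i) i})
            + ENNReal.ofReal (Fintype.card ι * Real.exp (-K ^ 2 / 2)) := by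
          rw [Finset.sum_add_distrib, ← Finset.mul_sum, measure_iUnion _ hmeas, tsum_fintype,
            ENNReal.ofReal_mul (by positivity)]
          · simp
          · intro i j hij
            exact disjoint_left.2 fun ω hi hj => hij (IsFirstArgmax.eq hi hj)
      _ ≤ ENNReal.ofReal (3 * (K + 1)) * 1 + ENNReal.ofReal 1 := by
          gcongr
          exact prob_le_one
      _ = _ := by
          rw [mul_one, ← ENNReal.ofReal_add (by positivity) (by norm_num)]
          congr 1; ring
  calc μ {ω | (∃ i, a i < W ω i) ∧ ∀ i, W ω i ≤ a i + h}
      ≤ μ (⋃ i, {ω | IsFirstArgmax (fun i => W ω i - a i) i ∧ W ω i ∈ Ioc (a i) (a i + h)}) := by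
        refine measure_mono ?_
        rintro ω ⟨⟨i, hi⟩, hall⟩
        have : Nonempty ι := ⟨i⟩
        obtain ⟨j, hj⟩ := exists_isFirstArgmax fun i => W ω i - a i
        refine mem_iUnion.2 ⟨j, hj, ?_, hall j⟩
        linarith [(hj i).1]
    _ ≤ ∑ i, ∫⁻ w in Ioc (a i) (a i + h), F i w := by
        refine (measure_iUnion_fintype_le _ _).trans (Finset.sum_le_sum fun i _ => ?_)
        exact (hint i _ measurableSet_Ioc).le
    _ = ∑ i, ∫⁻ s in Ioc 0 h, F i (a i + s) := by
        refine Finset.sum_congr rfl fun i _ => ?_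
        rw [← (measurePreserving_add_left volume (a i)).setLIntegral_comp_preimage
          measurableSet_Ioc (hF i)]
        simp
    _ = ∫⁻ s in Ioc 0 h, ∑ i, F i (a i + s) :=
        (lintegral_finsetSum _ fun i _ => (hF i).comp (measurable_const_add _)).symm
    _ ≤ ∫⁻ _ in Ioc 0 h, ENNReal.ofReal (3 * K + 4) := lintegral_mono fun s => hpoint s
    _ = _ := by rw [setLIntegral_const, Real.volume_Ioc, sub_zero]

lemma IsCenteredGaussianVec.hasGaussianLaw {Ω : Type*} [MeasurableSpace Ω] {μ : Measure Ω}
    {p : ℕ} {Y : Ω → Fin p → ℝ} (hY : IsCenteredGaussianVec μ Y) : HasGaussianLaw Y μ where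
  isGaussian_map := by
    refine isGaussian_of_map_eq_gaussianReal fun L => ?_
    obtain ⟨v, hv⟩ := hY.2.2 fun j => L (Pi.single j 1)
    refine ⟨0, v, ?_⟩
    rw [Measure.map_map (by fun_prop) hY.1, ← hv]
    congr 1
    ext ω
    have hsingle : ∀ j, Pi.single j (Y ω j) = Y ω j • (Pi.single j 1 : Fin p → ℝ) := fun j => by
      rw [← Pi.single_smul, smul_eq_mul, mul_one]
    calc L (Y ω) = L (∑ j, Pi.single j (Y ω j)) := by rw [Finset.univ_sum_single]
      _ = ∑ j, L (Pi.single j 1) * Y ω j := by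
        simp only [map_sum, hsingle, map_smul, smul_eq_mul, mul_comm]

lemma IsCenteredGaussianVec.map_eval {Ω : Type*} [MeasurableSpace Ω] {μ : Measure Ω}
    [IsProbabilityMeasure μ] {p : ℕ} {Y : Ω → Fin p → ℝ} (hY : IsCenteredGaussianVec μ Y)
    (j : Fin p) :
    μ.map (fun ω => Y ω j) = gaussianReal 0 (∫ ω, Y ω j * Y ω j ∂μ).toNNReal := by
  have hj := HasGaussianLaw.eval (X := fun j ω => Y ω j) hY.hasGaussianLaw j
  rw [hj.map_eq_gaussianReal, hY.2.1 j, variance_of_integral_eq_zero hj.aemeasurable (hY.2.1 j)]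
  simp only [sq]

/-- Shifting the threshold by `δ` changes the tail of the maximum of the absolute values
of a centered Gaussian vector by at most a multiple of `δ * √(log p)`. -/
lemma measure_lt_sup'_abs_le {Ω : Type*} [MeasurableSpace Ω] {μ : Measure Ω}
    [IsProbabilityMeasure μ] {p : ℕ} (hp : 2 ≤ p) {Y : Ω → Fin p → ℝ}
    (hY : IsCenteredGaussianVec μ Y) {c : ℝ} (hc : 0 < c)
    (hvar : ∀ j, c ≤ ∫ ω, Y ω j * Y ω j ∂μ) {δ : ℝ} (hδ : 0 < δ) (x : ℝ)
    (A : Finset (Fin p)) (hA : A.Nonempty) :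
    (μ {ω | x < A.sup' hA fun j => |Y ω j|}).toReal
      ≤ (μ {ω | x + δ < A.sup' hA fun j => |Y ω j|}).toReal
        + 14 / √c * δ * √(Real.log p) := by
  set v : Fin p → ℝ := fun j => ∫ ω, Y ω j * Y ω j ∂μ with hv
  have hv0 : ∀ j, 0 < v j := fun j => hc.trans_le (hvar j)
  have hσ0 : ∀ j, 0 < √(v j) := fun j => Real.sqrt_pos.2 (hv0 j)
  let f : A × Bool → ℝ := fun k => (if k.2 then 1 else -1) / √(v k.1)
  let W : Ω → A × Bool → ℝ := fun ω k => f k * Y ω k.1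
  have hYj : ∀ j, Measurable fun ω => Y ω j := fun j => (measurable_pi_apply j).comp hY.1
  have hW : Measurable W := measurable_pi_lambda _ fun k => (hYj _).const_mul _
  have hG : HasGaussianLaw W μ := by
    have := hY.hasGaussianLaw.map_fun (ContinuousLinearMap.pi fun k : A × Bool =>
      f k • ContinuousLinearMap.proj (R := ℝ) (φ := fun _ : Fin p => ℝ) k.1.1)
    exact this
  have hlaw : ∀ k, μ.map (fun ω => W ω k) = gaussianReal 0 1 := fun k => by
    have h := gaussianReal_map_const_mul (μ := 0) (v := (v k.1).toNNReal) (f k)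
    rw [← hY.map_eval k.1, Measure.map_map (by fun_prop) (hYj _)] at h
    refine h.trans ?_
    congr 1
    · simp
    · ext
      have hf : f k ^ 2 = (v k.1)⁻¹ := by
        simp only [f, div_pow, Real.sq_sqrt (hv0 _).le]
        split_ifs <;> simp
      simp only [NNReal.coe_mul, NNReal.coe_mk, hf, Real.coe_toNNReal _ (hv0 _).le]
      simpa using inv_mul_cancel₀ (hv0 k.1).ne'
  set l : ℝ := √(Real.log p) with hl
  have hp0 : (0 : ℝ) < p := by positivity
  have hp2 : (2 : ℝ) ≤ p := by exact_mod_cast hp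
  have hlog : 1 / 4 ≤ Real.log p := by
    have := Real.log_le_log two_pos hp2
    linarith [Real.log_two_gt_d9]
  have hl2 : 1 / 2 ≤ l := Real.le_sqrt_of_sq_le (by linarith)
  have hcard : Fintype.card (A × Bool) * Real.exp (-(2 * l) ^ 2 / 2) ≤ 1 := by
    have hexp : Real.exp (-(2 * l) ^ 2 / 2) = ((p : ℝ) ^ 2)⁻¹ := by
      rw [mul_pow, hl, Real.sq_sqrt (by linarith),
        show -(2 ^ 2 * Real.log p) / 2 = -(2 * Real.log p) by ring, Real.exp_neg, two_mul,
        Real.exp_add, Real.exp_log hp0, sq]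
    have hA' : (A.card : ℝ) ≤ p := by
      exact_mod_cast A.card_le_univ.trans_eq (Fintype.card_fin p)
    rw [hexp, ← div_eq_mul_inv, div_le_one (by positivity)]
    simp only [Fintype.card_prod, Fintype.card_coe, Fintype.card_bool, Nat.cast_mul,
      Nat.cast_ofNat]
    nlinarith
  have hsub : {ω | x < A.sup' hA fun j => |Y ω j|}
      ⊆ {ω | x + δ < A.sup' hA fun j => |Y ω j|} ∪
        {ω | (∃ k : A × Bool, x / √(v k.1) < W ω k) ∧
          ∀ k : A × Bool, W ω k ≤ x / √(v k.1) + δ / √c} := by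
    intro ω (hω : x < A.sup' hA fun j => |Y ω j|)
    refine (lt_or_ge (x + δ) (A.sup' hA fun j => |Y ω j|)).imp id fun hle => ⟨?_, fun k => ?_⟩
    · obtain ⟨j, hj, hxj⟩ := (Finset.lt_sup'_iff hA).1 hω
      rcases lt_abs.1 hxj with h | h
      · refine ⟨(⟨j, hj⟩, true), ?_⟩
        have := div_lt_div_of_pos_right h (hσ0 j)
        simpa [W, f, div_eq_mul_inv, mul_comm] using this
      · refine ⟨(⟨j, hj⟩, false), ?_⟩
        have := div_lt_div_of_pos_right h (hσ0 j)
        simpa [W, f, div_eq_mul_inv, mul_comm] using this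
    · have hk : |Y ω k.1| ≤ x + δ := (Finset.sup'_le_iff hA _).1 hle k.1 k.1.2
      calc W ω k = (if k.2 then Y ω k.1 else -Y ω k.1) / √(v k.1) := by
            simp only [W, f]; split_ifs <;> ring
        _ ≤ (x + δ) / √(v k.1) := by
            refine div_le_div_of_nonneg_right ?_ (hσ0 _).le
            split_ifs
            · exact (le_abs_self _).trans hk
            · exact (neg_le_abs _).trans hk
        _ ≤ _ := by
            rw [add_div]
            gcongr
            exact hvar _
  have hN := nazarov hW hG hlaw (fun k => x / √(v k.1)) (by positivity) hcard (δ / √c)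
  have hδc : 0 ≤ δ / √c := by positivity
  calc (μ {ω | x < A.sup' hA fun j => |Y ω j|}).toReal
      ≤ (μ {ω | x + δ < A.sup' hA fun j => |Y ω j|}
          + ENNReal.ofReal (3 * (2 * l) + 4) * ENNReal.ofReal (δ / √c)).toReal := by
        refine ENNReal.toReal_mono (by finiteness) ?_
        exact (measure_mono hsub).trans ((measure_union_le _ _).trans (by gcongr))
    _ = (μ {ω | x + δ < A.sup' hA fun j => |Y ω j|}).toReal
          + (3 * (2 * l) + 4) * (δ / √c) := by
        rw [ENNReal.toReal_add (by finiteness) (by finiteness), ENNReal.toReal_mul,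
          ENNReal.toReal_ofReal (by positivity), ENNReal.toReal_ofReal hδc]
    _ ≤ _ := by
        have : 14 / √c * δ * l = 14 * l * (δ / √c) := by ring
        rw [this]
        gcongr
        linarith

lemma measure_abs_gt_le {Ω : Type*} [MeasurableSpace Ω] {μ : Measure Ω} [IsFiniteMeasure μ]
    (X Z : Ω → ℝ) (x δ : ℝ) :
    (μ {ω | x + δ < |X ω|}).toReal
      ≤ (μ {ω | x < |Z ω|}).toReal + (μ {ω | δ < |X ω - Z ω|}).toReal := by
  rw [← ENNReal.toReal_add (by finiteness) (by finiteness)]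
  refine ENNReal.toReal_mono (by finiteness) ((measure_mono fun ω hω => ?_).trans
    (measure_union_le _ _))
  refine (lt_or_ge x |Z ω|).imp id fun h => ?_
  have h1 : x + δ < |X ω| := hω
  show δ < |X ω - Z ω|
  linarith [abs_sub_abs_le_abs_sub (X ω) (Z ω)]

lemma abs_toReal_sub_toReal_le_one {a b : ℝ≥0∞} (ha : a ≤ 1) (hb : b ≤ 1) :
    |a.toReal - b.toReal| ≤ 1 := by
  have h1 := ENNReal.toReal_mono ENNReal.one_ne_top ha
  have h2 := ENNReal.toReal_mono ENNReal.one_ne_top hb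
  rw [ENNReal.toReal_one] at h1 h2
  exact abs_le.2 ⟨by linarith [ENNReal.toReal_nonneg (a := a)],
    by linarith [ENNReal.toReal_nonneg (a := b)]⟩

/-- Lemma SI.3, second part, via the Nazarov inequality.  If `Y` is a
`p`-dimensional centered Gaussian vector (`p ≥ 2`) with `E Y_j² ≥ c₁ > 0` for all `j`,
then for any random variables `X, X'` and any `δ > 0`,
`sup_{x,A} |P(|X'|>x) − P(|Y[A]|_∞>x)|
  ≤ sup_{x,A} |P(|X|>x) − P(|Y[A]|_∞>x)| + P(|X−X'|>δ) + C δ √(log p)`,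
where the constant `C` depends only on `c₁`. -/
theorem statement18 :
    ∀ c₁ > (0 : ℝ), ∃ C > (0 : ℝ), ∀ (p : ℕ), 2 ≤ p →
      ∀ (Ω : Type) (mΩ : MeasurableSpace Ω) (μ : Measure Ω), IsProbabilityMeasure μ →
      ∀ (X X' : Ω → ℝ) (Y : Ω → Fin p → ℝ),
        IsCenteredGaussianVec μ Y →
        (∀ j, c₁ ≤ ∫ ω, Y ω j * Y ω j ∂μ) →
        ∀ δ > (0 : ℝ),
        (⨆ x : ℝ, ⨆ A : {A : Finset (Fin p) // A.Nonempty},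
            |(μ {ω | x < |X' ω|}).toReal
              - (μ {ω | x < (A : Finset (Fin p)).sup' A.2 fun j => |Y ω j|}).toReal|)
        ≤ (⨆ x : ℝ, ⨆ A : {A : Finset (Fin p) // A.Nonempty},
            |(μ {ω | x < |X ω|}).toReal
              - (μ {ω | x < (A : Finset (Fin p)).sup' A.2 fun j => |Y ω j|}).toReal|)
          + (μ {ω | δ < |X ω - X' ω|}).toReal
          + C * δ * Real.sqrt (Real.log p) := by

  intro c hc
  refine ⟨14 / √c, by positivity, fun p hp Ω _ μ _ X X' Y hY hvar δ hδ => ?_⟩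
  have : Nonempty {A : Finset (Fin p) // A.Nonempty} :=
    ⟨⟨{⟨0, by lia⟩}, Finset.singleton_nonempty _⟩⟩
  set D : ℝ → {A : Finset (Fin p) // A.Nonempty} → ℝ := fun x A =>
    |(μ {ω | x < |X ω|}).toReal
      - (μ {ω | x < (A : Finset (Fin p)).sup' A.2 fun j => |Y ω j|}).toReal| with hD
  have hle1 : ∀ x A, D x A ≤ 1 := fun x A =>
    abs_toReal_sub_toReal_le_one prob_le_one prob_le_one
  have hsup : ∀ x A, D x A ≤ ⨆ x, ⨆ A, D x A := fun x A =>
    (le_ciSup ⟨1, forall_mem_range.2 (hle1 x)⟩ A).trans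
      (le_ciSup (f := fun x => ⨆ A, D x A) ⟨1, forall_mem_range.2 fun x => ciSup_le (hle1 x)⟩ x)
  refine ciSup_le fun x => ciSup_le fun A => abs_sub_le_iff.2 ⟨?_, ?_⟩
  · have h1 := measure_abs_gt_le (μ := μ) X' X (x - δ) δ
    have h2 := measure_lt_sup'_abs_le hp hY hc hvar hδ (x - δ) A A.2
    have h3 := (le_abs_self _).trans (hsup (x - δ) A)
    simp only [abs_sub_comm (X' _) (X _)] at h1
    rw [sub_add_cancel] at h1 h2
    linarith
  · have h1 := measure_abs_gt_le (μ := μ) X X' x δ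
    have h2 := measure_lt_sup'_abs_le hp hY hc hvar hδ x A A.2
    have h3 := (neg_le_abs _).trans (hsup (x + δ) A)
    linarith

end AJDN
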